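/- Let (G,u) be a maximum flow instance with |E| = m and let f be a feasible flow with val(f) ≥ 0. Then f can be written as f = Σ_{i∈[k_p]} g_i + Σ_{j∈[k_c]} h_j, where k_p + k_c ≤ m, each g_i is an s–t path flow, and each h_j is a cycle flow. -/

import Mathlib

open scoped ENNReal Classical

noncomputable section

/-- A maximum flow instance: a finite directed graph (parallel arcs allowed, no
self-loops) with distinct source `s` and sink `t`, a fixed-point-free reversal
involution on arcs, and capacities in `[0,∞]`. -/
structure FlowInstance (V E : Type) [Fintype V] [Fintype E] [DecidableEq V] where
  tail : E → V
  head : E → V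
  s : V
  t : V
  s_ne_t : s ≠ t
  rev : E → E
  rev_rev : ∀ e, rev (rev e) = e
  rev_ne : ∀ e, rev e ≠ e
  tail_rev : ∀ e, tail (rev e) = head e
  head_rev : ∀ e, head (rev e) = tail e
  no_loop : ∀ e, tail e ≠ head e
  u : E → ℝ≥0∞

namespace FlowInstance

variable {V E : Type} [Fintype V] [Fintype E] [DecidableEq V]

/-- The excess of a node: total inflow minus total outflow. -/
def excess (I : FlowInstance V E) (f : E → ℝ) (i : V) : ℝ :=
  ∑ e ∈ Finset.univ.filter (fun e => I.head e = i), f e -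
    ∑ e ∈ Finset.univ.filter (fun e => I.tail e = i), f e

/-- A feasible flow: nonnegative, within capacities, and conserving at every
node other than `s` and `t`. -/
def Feasible (I : FlowInstance V E) (f : E → ℝ) : Prop :=
  (∀ e, 0 ≤ f e) ∧ (∀ e, ENNReal.ofReal (f e) ≤ I.u e) ∧
    ∀ i, i ≠ I.s → i ≠ I.t → I.excess f i = 0

/-- The value of a flow. -/
def val (I : FlowInstance V E) (f : E → ℝ) : ℝ := -I.excess f I.s

/-- The set of values of feasible flows. -/
def flowValues (I : FlowInstance V E) : Set ℝ := {x | ∃ f, I.Feasible f ∧ I.val f = x}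

/-- The maximum flow value `ν(G,u)` (as a real supremum). -/
def maxFlowVal (I : FlowInstance V E) : ℝ := sSup I.flowValues

/-- The instance is bounded if `ν(G,u) < ∞`. -/
def Bounded (I : FlowInstance V E) : Prop := BddAbove I.flowValues

/-- Residual capacities `u^f_e = u_e - f_e + f_{rev e}` of a flow. -/
def residual (I : FlowInstance V E) (f : E → ℝ) : E → ℝ≥0∞ :=
  fun e => I.u e - ENNReal.ofReal (f e) + ENNReal.ofReal (f (I.rev e))

/-- The instance on the same graph with capacities replaced by `u'`. -/
def withCapacity (I : FlowInstance V E) (u' : E → ℝ≥0∞) : FlowInstance V E :=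
  { I with u := u' }

/-- An `s`–`t` cut. -/
def IsCut (I : FlowInstance V E) (S : Finset V) : Prop := I.s ∈ S ∧ I.t ∉ S

/-- The capacity `u(S, V∖S)` of a cut. -/
def cutCap (I : FlowInstance V E) (S : Finset V) : ℝ≥0∞ :=
  ∑ e ∈ Finset.univ.filter (fun e => I.tail e ∈ S ∧ I.head e ∉ S), I.u e

/-- The total residual capacity `u^f(S, V∖S)` of a cut. -/
def resCutCap (I : FlowInstance V E) (f : E → ℝ) (S : Finset V) : ℝ≥0∞ :=
  ∑ e ∈ Finset.univ.filter (fun e => I.tail e ∈ S ∧ I.head e ∉ S), I.residual f e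

/-- A directed path from `x` to `y` through pairwise distinct nodes using only
arcs from `A`. -/
def IsDiPath (I : FlowInstance V E) (A : Set E) (x y : V) : Prop :=
  ∃ (k : ℕ) (v : Fin (k + 1) → V) (es : Fin k → E),
    v 0 = x ∧ v (Fin.last k) = y ∧ Function.Injective v ∧
    ∀ i : Fin k, es i ∈ A ∧ I.tail (es i) = v i.castSucc ∧ I.head (es i) = v i.succ

/-- `A` contains a directed cycle: a head-to-tail sequence of arcs of `A` through
pairwise distinct nodes returning to its starting node. -/
def HasDiCycle (I : FlowInstance V E) (A : Set E) : Prop :=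
  ∃ (k : ℕ) (v : Fin (k + 1) → V) (es : Fin (k + 1) → E),
    Function.Injective v ∧
    ∀ i : Fin (k + 1), es i ∈ A ∧ I.tail (es i) = v i ∧ I.head (es i) = v (i + 1)

/-- The constant `Γ = 4 n²` where `n = |V|`. -/
def Gamma (I : FlowInstance V E) : ℝ := 4 * (Fintype.card V : ℝ) ^ 2

end FlowInstance

/-- `I'` extends `I`: same node set, same `s` and `t`, the arc set of `I'` contains
that of `I` (via the injection `ι`), with the same endpoints, capacities and
reversal involution on the arcs of `I`. -/
def IsExtension {V E E' : Type} [Fintype V] [Fintype E] [Fintype E'] [DecidableEq V]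
    (I : FlowInstance V E) (I' : FlowInstance V E') (ι : E → E') : Prop :=
  Function.Injective ι ∧ I'.s = I.s ∧ I'.t = I.t ∧
    (∀ e, I'.tail (ι e) = I.tail e) ∧ (∀ e, I'.head (ι e) = I.head e) ∧
    (∀ e, I'.rev (ι e) = ι (I.rev e)) ∧ (∀ e, I'.u (ι e) = I.u e)

/-- An `s`–`t` path flow: nonnegative, supported exactly on the arc set of a
directed path from `s` to `t` (through pairwise distinct nodes), taking a single
common positive value on all arcs of the path. -/
def FlowInstance.IsPathFlow {V E : Type} [Fintype V] [Fintype E] [DecidableEq V]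
    (I : FlowInstance V E) (g : E → ℝ) : Prop :=
  ∃ (k : ℕ) (v : Fin (k + 1) → V) (es : Fin k → E) (c : ℝ),
    0 < c ∧ v 0 = I.s ∧ v (Fin.last k) = I.t ∧ Function.Injective v ∧
    (∀ i : Fin k, I.tail (es i) = v i.castSucc ∧ I.head (es i) = v i.succ) ∧
    ∀ e, g e = if e ∈ Set.range es then c else 0

/-- A cycle flow: nonnegative, supported exactly on the arc set of a directed
cycle (through pairwise distinct nodes), taking a single common positive value
on all arcs of the cycle. -/
def FlowInstance.IsCycleFlow {V E : Type} [Fintype V] [Fintype E] [DecidableEq V]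
    (I : FlowInstance V E) (g : E → ℝ) : Prop :=
  ∃ (k : ℕ) (v : Fin (k + 1) → V) (es : Fin (k + 1) → E) (c : ℝ),
    0 < c ∧ Function.Injective v ∧
    (∀ i : Fin (k + 1), I.tail (es i) = v i ∧ I.head (es i) = v (i + 1)) ∧
    ∀ e, g e = if e ∈ Set.range es then c else 0

namespace FlowInstance

variable {V E : Type} [Fintype V] [Fintype E] [DecidableEq V]

lemma excess_eq_sum (I : FlowInstance V E) (f : E → ℝ) (i : V) :
    I.excess f i =
      ∑ e, ((if I.head e = i then f e else 0) - (if I.tail e = i then f e else 0)) := by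
  simp only [excess, Finset.sum_filter, Finset.sum_sub_distrib]

lemma sum_excess (I : FlowInstance V E) (f : E → ℝ) (R : Finset V) :
    ∑ i ∈ R, I.excess f i =
      ∑ e, ((if I.head e ∈ R then f e else 0) - (if I.tail e ∈ R then f e else 0)) := by
  simp only [excess_eq_sum]
  rw [Finset.sum_comm]
  simp only [Finset.sum_sub_distrib, Finset.sum_ite_eq]

lemma excess_sub (I : FlowInstance V E) (f g : E → ℝ) (i : V) :
    I.excess (f - g) i = I.excess f i - I.excess g i := by
  simp only [excess, Pi.sub_apply, Finset.sum_sub_distrib]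
  ring

lemma val_sub (I : FlowInstance V E) (f g : E → ℝ) :
    I.val (f - g) = I.val f - I.val g := by
  simp only [val, excess_sub]
  ring

lemma excess_sink (I : FlowInstance V E) {f : E → ℝ}
    (hcons : ∀ i, i ≠ I.s → i ≠ I.t → I.excess f i = 0) : I.excess f I.t = I.val f := by
  have h0 : ∑ i, I.excess f i = 0 := by simp [sum_excess]
  have h1 : ∑ i, I.excess f i = I.excess f I.s + I.excess f I.t :=
    Fintype.sum_eq_add _ _ I.s_ne_t fun i hi => hcons i hi.1 hi.2
  simp only [val]
  linarith

lemma excess_eq_zero_of_val_eq_zero (I : FlowInstance V E) {f : E → ℝ}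
    (hcons : ∀ i, i ≠ I.s → i ≠ I.t → I.excess f i = 0) (hval : I.val f = 0) (i : V) :
    I.excess f i = 0 := by
  by_cases hs : i = I.s
  · rw [hs]
    exact neg_eq_zero.mp hval
  by_cases ht : i = I.t
  · rw [ht, I.excess_sink hcons, hval]
  exact hcons i hs ht

/-- The net inflow of each arc into a node set that no flow leaves is nonnegative. -/
lemma net_inflow_nonneg (I : FlowInstance V E) {f : E → ℝ} (hf : ∀ e, 0 ≤ f e) {R : Finset V}
    (hR : ∀ e, 0 < f e → I.tail e ∈ R → I.head e ∈ R) (e : E) :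
    0 ≤ (if I.head e ∈ R then f e else 0) - (if I.tail e ∈ R then f e else 0) := by
  have := hf e
  have := hR e
  split_ifs with h1 h2 h2 <;> first | linarith | skip
  by_contra hlt
  exact h1 (hR e (by linarith) h2)

lemma sum_excess_nonneg (I : FlowInstance V E) {f : E → ℝ} (hf : ∀ e, 0 ≤ f e) {R : Finset V}
    (hR : ∀ e, 0 < f e → I.tail e ∈ R → I.head e ∈ R) : 0 ≤ ∑ i ∈ R, I.excess f i := by
  rw [sum_excess]
  exact Finset.sum_nonneg fun e _ => I.net_inflow_nonneg hf hR e

lemma le_sum_excess (I : FlowInstance V E) {f : E → ℝ} (hf : ∀ e, 0 ≤ f e) {R : Finset V}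
    (hR : ∀ e, 0 < f e → I.tail e ∈ R → I.head e ∈ R) {e : E} (hh : I.head e ∈ R)
    (ht : I.tail e ∉ R) : f e ≤ ∑ i ∈ R, I.excess f i := by
  rw [sum_excess]
  refine le_trans ?_ (Finset.single_le_sum (fun e _ => I.net_inflow_nonneg hf hR e)
    (Finset.mem_univ e))
  simp [hh, ht]

/-- One node is the tail and the other the head of a common arc of `A`. -/
def ArcRel (I : FlowInstance V E) (A : Set E) (x y : V) : Prop :=
  ∃ e ∈ A, I.tail e = x ∧ I.head e = y

lemma exists_simple_path [Nonempty E] (I : FlowInstance V E) {A : Set E} {x y : V}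
    (h : Relation.ReflTransGen (I.ArcRel A) x y) :
    ∃ (k : ℕ) (v : ℕ → V) (es : ℕ → E), v 0 = x ∧ v k = y ∧ Set.InjOn v (Set.Iic k) ∧
      ∀ i < k, es i ∈ A ∧ I.tail (es i) = v i ∧ I.head (es i) = v (i + 1) := by
  induction h using Relation.ReflTransGen.head_induction_on with
  | refl =>
    exact ⟨0, fun _ => y, fun _ => Classical.arbitrary E, rfl, rfl, by simp [Set.InjOn], by simp⟩
  | @head a b hab _ ih =>
    obtain ⟨e, heA, het, heh⟩ := hab
    obtain ⟨k, v, es, h0, hk, hinj, hes⟩ := ih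
    by_cases ha : ∃ j ≤ k, v j = a
    · obtain ⟨j, hj, hja⟩ := ha
      refine ⟨k - j, fun n => v (n + j), fun n => es (n + j), by simpa using hja, ?_, ?_, ?_⟩
      · simpa [Nat.sub_add_cancel hj] using hk
      · intro p hp q hq hpq
        simp only [Set.mem_Iic] at hp hq
        have := hinj (x₁ := p + j) (x₂ := q + j) (by simp; omega) (by simp; omega) hpq
        omega
      · intro i hi
        have := hes (i + j) (by omega)
        rwa [show i + j + 1 = i + 1 + j by omega] at this
    · push Not at ha
      refine ⟨k + 1, fun n => Nat.casesOn n a v, fun n => Nat.casesOn n e es, rfl, hk, ?_, ?_⟩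
      · rintro (_ | p) hp (_ | q) hq hpq
        · rfl
        · exact absurd hpq.symm (ha q (by simpa using hq))
        · exact absurd hpq (ha p (by simpa using hp))
        · exact congrArg _ (hinj (by simpa using hp) (by simpa using hq) hpq)
      · rintro (_ | i) hi
        · exact ⟨heA, het, heh.trans h0.symm⟩
        · exact hes i (by omega)

lemma reflTransGen_of_cut (I : FlowInstance V E) {f : E → ℝ} {x y : V}
    (h : ∀ R : Finset V, x ∈ R → (∀ e, 0 < f e → I.tail e ∈ R → I.head e ∈ R) → y ∈ R) :
    Relation.ReflTransGen (I.ArcRel {e | 0 < f e}) x y := by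
  have := h (Finset.univ.filter (Relation.ReflTransGen (I.ArcRel {e | 0 < f e}) x))
    (by simpa using Relation.ReflTransGen.refl)
    (by
      intro e he ht
      simp only [Finset.mem_filter, Finset.mem_univ, true_and] at ht ⊢
      exact ht.tail ⟨e, he, rfl, rfl⟩)
  simpa using this

lemma exists_path_of_val_pos (I : FlowInstance V E) {f : E → ℝ} (hf : ∀ e, 0 ≤ f e)
    (hcons : ∀ i, i ≠ I.s → i ≠ I.t → I.excess f i = 0) (hval : 0 < I.val f) :
    ∃ (k : ℕ) (v : Fin (k + 1) → V) (es : Fin k → E),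
      v 0 = I.s ∧ v (Fin.last k) = I.t ∧ Function.Injective v ∧
      ∀ i : Fin k, 0 < f (es i) ∧ I.tail (es i) = v i.castSucc ∧ I.head (es i) = v i.succ := by
  have : Nonempty E := by
    by_contra hE
    rw [not_nonempty_iff] at hE
    simp [val, excess] at hval
  obtain ⟨k, v, es, h0, hk, hinj, hes⟩ := I.exists_simple_path (x := I.s) (y := I.t)
    (I.reflTransGen_of_cut (f := f) fun R hs hR => by
      by_contra ht
      have h1 := I.sum_excess_nonneg hf hR
      have h2 : ∑ i ∈ R, I.excess f i = I.excess f I.s :=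
        Finset.sum_eq_single_of_mem _ hs fun i hi his =>
          hcons i his fun hit => ht (hit ▸ hi)
      simp only [val] at hval
      linarith)
  refine ⟨k, fun i => v i, fun i => es i, h0, hk, fun p q hpq => ?_, fun i => hes i i.2⟩
  exact Fin.ext (hinj (by simp; omega) (by simp; omega) hpq)

lemma exists_cycle_of_circulation (I : FlowInstance V E) {f : E → ℝ} (hf : ∀ e, 0 ≤ f e)
    (hcons : ∀ i, I.excess f i = 0) {e : E} (he : 0 < f e) :
    ∃ (k : ℕ) (v : Fin (k + 1) → V) (es : Fin (k + 1) → E), Function.Injective v ∧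
      ∀ i : Fin (k + 1), 0 < f (es i) ∧ I.tail (es i) = v i ∧ I.head (es i) = v (i + 1) := by
  have : Nonempty E := ⟨e⟩
  obtain ⟨k, v, es, h0, hk, hinj, hes⟩ := I.exists_simple_path (x := I.head e) (y := I.tail e)
    (I.reflTransGen_of_cut (f := f) fun R hs hR => by
      by_contra ht
      have h1 := I.le_sum_excess hf hR hs ht
      simp only [hcons, Finset.sum_const_zero] at h1
      linarith)
  refine ⟨k, fun i => v i, fun i => if (i : ℕ) < k then es i else e, fun p q hpq => ?_,
    fun i => ?_⟩
  · exact Fin.ext (hinj (by simp; omega) (by simp; omega) hpq)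
  · by_cases hi : (i : ℕ) < k
    · have : ((i + 1 : Fin (k + 1)) : ℕ) = i + 1 :=
        Fin.val_add_one_of_lt (by simpa [Fin.lt_def] using hi)
      simpa only [hi, if_true, this, Set.mem_ofPred_eq] using hes i hi
    · have hik : i = Fin.last k := Fin.ext (by simp; omega)
      subst hik
      simp [he, h0, hk]

lemma sum_ite_range {ι : Type} [Fintype ι] {es : ι → E} (hes : Function.Injective es)
    {g : E → ℝ} {c : ℝ} (hg : ∀ e, g e = if e ∈ Set.range es then c else 0)
    (p : E → Prop) [DecidablePred p] :
    ∑ e, (if p e then g e else 0) = ∑ j, if p (es j) then c else 0 := by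
  have h : ∀ e ∉ Set.range es, (if p e then g e else 0) = 0 := by
    intro e he
    simp [hg, he]
  rw [← Fintype.sum_of_injective es hes (fun j => if p (es j) then c else 0) _ h]
  intro j
  simp [hg]

lemma excess_path (I : FlowInstance V E) {k : ℕ} {v : Fin (k + 1) → V} {es : Fin k → E}
    {g : E → ℝ} {c : ℝ} (hinj : Function.Injective v)
    (hes : ∀ i : Fin k, I.tail (es i) = v i.castSucc ∧ I.head (es i) = v i.succ)
    (hg : ∀ e, g e = if e ∈ Set.range es then c else 0) (i : V) :
    I.excess g i = (if v (Fin.last k) = i then c else 0) - (if v 0 = i then c else 0) := by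
  have hesinj : Function.Injective es := fun p q hpq =>
    Fin.castSucc_injective k (hinj (by rw [← (hes p).1, ← (hes q).1, hpq]))
  rw [excess_eq_sum, Finset.sum_sub_distrib, sum_ite_range hesinj hg, sum_ite_range hesinj hg]
  simp only [hes]
  have h1 := Fin.sum_univ_succ fun j => if v j = i then c else 0
  have h2 := Fin.sum_univ_castSucc fun j => if v j = i then c else 0
  linarith

lemma excess_cycle (I : FlowInstance V E) {k : ℕ} {v : Fin (k + 1) → V} {es : Fin (k + 1) → E}
    {g : E → ℝ} {c : ℝ} (hinj : Function.Injective v)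
    (hes : ∀ i : Fin (k + 1), I.tail (es i) = v i ∧ I.head (es i) = v (i + 1))
    (hg : ∀ e, g e = if e ∈ Set.range es then c else 0) (i : V) : I.excess g i = 0 := by
  have hesinj : Function.Injective es := fun p q hpq =>
    hinj (by rw [← (hes p).1, ← (hes q).1, hpq])
  rw [excess_eq_sum, Finset.sum_sub_distrib, sum_ite_range hesinj hg, sum_ite_range hesinj hg]
  simp only [hes]
  rw [sub_eq_zero]
  exact Equiv.sum_comp (Equiv.addRight (1 : Fin (k + 1))) fun j => if v j = i then c else 0

/-- `f` is a sum of at most `n` path flows and cycle flows. -/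
def Decomposes (I : FlowInstance V E) (n : ℕ) (f : E → ℝ) : Prop :=
  ∃ (kp kc : ℕ) (g : Fin kp → E → ℝ) (h : Fin kc → E → ℝ),
    kp + kc ≤ n ∧ (∀ i, I.IsPathFlow (g i)) ∧ (∀ j, I.IsCycleFlow (h j)) ∧
    f = (∑ i, g i) + ∑ j, h j

lemma decomposes_zero (I : FlowInstance V E) (n : ℕ) : I.Decomposes n 0 :=
  ⟨0, 0, Fin.elim0, Fin.elim0, by simp, fun i => i.elim0, fun i => i.elim0, by simp⟩

lemma Decomposes.of_sub_path {I : FlowInstance V E} {n : ℕ} {f p : E → ℝ}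
    (hp : I.IsPathFlow p) (hf : I.Decomposes n (f - p)) : I.Decomposes (n + 1) f := by
  obtain ⟨kp, kc, g, h, hn, hg, hh, hsum⟩ := hf
  refine ⟨kp + 1, kc, Fin.cons p g, h, by omega, Fin.cases hp hg, hh, ?_⟩
  rw [Fin.sum_univ_succ]
  simp only [Fin.cons_zero, Fin.cons_succ]
  rw [add_assoc, ← hsum, add_sub_cancel]

lemma Decomposes.of_sub_cycle {I : FlowInstance V E} {n : ℕ} {f p : E → ℝ}
    (hp : I.IsCycleFlow p) (hf : I.Decomposes n (f - p)) : I.Decomposes (n + 1) f := by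
  obtain ⟨kp, kc, g, h, hn, hg, hh, hsum⟩ := hf
  refine ⟨kp, kc + 1, g, Fin.cons p h, by omega, hg, Fin.cases hp hh, ?_⟩
  rw [Fin.sum_univ_succ]
  simp only [Fin.cons_zero, Fin.cons_succ]
  rw [add_left_comm, ← hsum, add_sub_cancel]

/-- The number of arcs carrying flow, plus one if the flow has positive value. -/
def decompositionRank (I : FlowInstance V E) (f : E → ℝ) : ℕ :=
  (Finset.univ.filter fun e => 0 < f e).card + if 0 < I.val f then 1 else 0

lemma two_le_decompositionRank (I : FlowInstance V E) {f : E → ℝ} (hf : ∀ e, 0 ≤ f e)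
    (hcons : ∀ i, i ≠ I.s → i ≠ I.t → I.excess f i = 0) (hval : 0 ≤ I.val f)
    {e : E} (he : 0 < f e) : 2 ≤ I.decompositionRank f := by
  have hmem : e ∈ Finset.univ.filter fun e => 0 < f e := by simpa using he
  unfold decompositionRank
  split_ifs with hv
  · have := Finset.card_pos.mpr ⟨e, hmem⟩
    omega
  · refine Finset.one_lt_card.mpr ?_
    by_contra! hall
    have hex := I.excess_eq_zero_of_val_eq_zero hcons (le_antisymm (not_lt.mp hv) hval)
      (I.head e)
    have := I.le_sum_excess hf (R := {I.head e}) (e := e)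
      (fun e' he' ht => by
        have : e = e' := hall e hmem e' (by simpa using he')
        subst this
        simp) (by simp) (by simpa using I.no_loop e)
    simp only [Finset.sum_singleton, hex] at this
    linarith

lemma card_pos_sub_le {f g : E → ℝ} (hg : ∀ e, 0 ≤ g e) :
    (Finset.univ.filter fun e => 0 < (f - g) e).card ≤
      (Finset.univ.filter fun e => 0 < f e).card := by
  refine Finset.card_le_card fun e he => ?_
  have := hg e
  simp only [Finset.mem_filter, Finset.mem_univ, true_and, Pi.sub_apply] at he ⊢
  linarith

lemma card_pos_sub_lt {f g : E → ℝ} (hg : ∀ e, 0 ≤ g e) {e : E} (he : 0 < f e)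
    (heq : g e = f e) :
    (Finset.univ.filter fun e => 0 < (f - g) e).card <
      (Finset.univ.filter fun e => 0 < f e).card := by
  refine Finset.card_lt_card ((Finset.ssubset_iff_of_subset fun e he => ?_).mpr
    ⟨e, by simpa using he, by simp [heq]⟩)
  have := hg e
  simp only [Finset.mem_filter, Finset.mem_univ, true_and, Pi.sub_apply] at he ⊢
  linarith

/-- A nonnegative conserving flow of positive value admits a path flow whose removal
lowers the rank. -/
lemma exists_isPathFlow_sub (I : FlowInstance V E) {f : E → ℝ} (hf : ∀ e, 0 ≤ f e)
    (hcons : ∀ i, i ≠ I.s → i ≠ I.t → I.excess f i = 0) (hval : 0 < I.val f) :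
    ∃ g, I.IsPathFlow g ∧ (∀ e, 0 ≤ (f - g) e) ∧
      (∀ i, i ≠ I.s → i ≠ I.t → I.excess (f - g) i = 0) ∧ 0 ≤ I.val (f - g) ∧
      I.decompositionRank (f - g) < I.decompositionRank f := by
  obtain ⟨k, v, es, h0, hk, hinj, hes⟩ := I.exists_path_of_val_pos hf hcons hval
  have hk0 : k ≠ 0 := by
    rintro rfl
    exact I.s_ne_t (h0.symm.trans hk)
  have : Nonempty (Fin k) := ⟨⟨0, Nat.pos_of_ne_zero hk0⟩⟩
  obtain ⟨j, hj⟩ := Finite.exists_min fun i => f (es i)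
  obtain ⟨c, hc⟩ : ∃ c, c = min (I.val f) (f (es j)) := ⟨_, rfl⟩
  have hcv : c ≤ I.val f := hc ▸ min_le_left _ _
  have hcj : c ≤ f (es j) := hc ▸ min_le_right _ _
  have hc0 : 0 < c := hc ▸ lt_min hval (hes j).1
  obtain ⟨g, hg⟩ : ∃ g : E → ℝ, ∀ e, g e = if e ∈ Set.range es then c else 0 :=
    ⟨_, fun _ => rfl⟩
  have hex := I.excess_path hinj (fun i => (hes i).2) hg
  have hvg : I.val g = c := by simp [val, hex, h0, hk, I.s_ne_t.symm]
  have hg0 : ∀ e, 0 ≤ g e := fun e => by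
    rw [hg]
    split_ifs
    exacts [hc0.le, le_rfl]
  refine ⟨g, ⟨k, v, es, c, hc0, h0, hk, hinj, fun i => (hes i).2, hg⟩, fun e => ?_,
    fun i his hit => ?_, ?_, ?_⟩
  · rw [Pi.sub_apply, hg]
    split_ifs with h
    · obtain ⟨i, rfl⟩ := h
      linarith [hj i]
    · simpa using hf e
  · rw [excess_sub, hcons i his hit, hex, h0, hk]
    simp [his.symm, hit.symm]
  · rw [val_sub, hvg]
    linarith
  · unfold decompositionRank
    rw [if_pos hval]
    rcases min_choice (I.val f) (f (es j)) with h | h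
    · have := card_pos_sub_le (f := f) hg0
      rw [if_neg (by rw [val_sub, hvg, hc, h]; simp)]
      omega
    · have := card_pos_sub_lt hg0 (hes j).1 (by simp [hg, hc, h])
      split_ifs <;> omega

/-- A nonzero circulation admits a cycle flow whose removal lowers the rank. -/
lemma exists_isCycleFlow_sub (I : FlowInstance V E) {f : E → ℝ} (hf : ∀ e, 0 ≤ f e)
    (hcons : ∀ i, I.excess f i = 0) {e : E} (he : 0 < f e) :
    ∃ g, I.IsCycleFlow g ∧ (∀ e, 0 ≤ (f - g) e) ∧ (∀ i, I.excess (f - g) i = 0) ∧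
      I.decompositionRank (f - g) < I.decompositionRank f := by
  obtain ⟨k, v, es, hinj, hes⟩ := I.exists_cycle_of_circulation hf hcons he
  obtain ⟨j, hj⟩ := Finite.exists_min fun i => f (es i)
  obtain ⟨g, hg⟩ : ∃ g : E → ℝ, ∀ e, g e = if e ∈ Set.range es then f (es j) else 0 :=
    ⟨_, fun _ => rfl⟩
  have hex := I.excess_cycle hinj (fun i => (hes i).2) hg
  have hg0 : ∀ e, 0 ≤ g e := fun e => by
    rw [hg]
    split_ifs
    exacts [hf _, le_rfl]
  refine ⟨g, ⟨k, v, es, _, (hes j).1, hinj, fun i => (hes i).2, hg⟩, fun e => ?_,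
    fun i => ?_, ?_⟩
  · rw [Pi.sub_apply, hg]
    split_ifs with h
    · obtain ⟨i, rfl⟩ := h
      linarith [hj i]
    · simpa using hf e
  · rw [excess_sub, hcons i, hex, sub_zero]
  · have := card_pos_sub_lt hg0 (hes j).1 (by simp [hg])
    simpa [decompositionRank, val, excess_sub, hcons, hex] using this

lemma decomposes_of_decompositionRank_le (I : FlowInstance V E) (n : ℕ) {f : E → ℝ}
    (hf : ∀ e, 0 ≤ f e) (hcons : ∀ i, i ≠ I.s → i ≠ I.t → I.excess f i = 0)
    (hval : 0 ≤ I.val f) (hn : I.decompositionRank f ≤ n + 1) : I.Decomposes n f := by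
  induction n generalizing f with
  | zero =>
    have hf0 : f = 0 := by
      funext e
      by_contra hne
      have := I.two_le_decompositionRank hf hcons hval (lt_of_le_of_ne (hf e) (Ne.symm hne))
      omega
    exact hf0 ▸ I.decomposes_zero 0
  | succ n ih =>
    rcases hval.lt_or_eq with hv | hv
    · obtain ⟨g, hg, h1, h2, h3, h4⟩ := I.exists_isPathFlow_sub hf hcons hv
      exact (ih h1 h2 h3 (by omega)).of_sub_path hg
    by_cases hf0 : f = 0
    · exact hf0 ▸ I.decomposes_zero _
    obtain ⟨e, hne⟩ := Function.ne_iff.mp hf0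
    have hcirc := I.excess_eq_zero_of_val_eq_zero hcons hv.symm
    obtain ⟨g, hg, h1, h2, h3⟩ :=
      I.exists_isCycleFlow_sub hf hcirc (lt_of_le_of_ne (hf e) (Ne.symm hne))
    exact (ih h1 (fun i _ _ => h2 i) (by simp [val, h2]) (by omega)).of_sub_cycle hg

end FlowInstance

/-- Flow decomposition: a feasible flow of nonnegative value is the sum of at
most `m` `s`–`t` path flows and cycle flows. -/
theorem flow_decomposition
    {V E : Type} [Fintype V] [Fintype E] [DecidableEq V]
    (I : FlowInstance V E)
    (f : E → ℝ) (hf : I.Feasible f) (hval : 0 ≤ I.val f) :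
    ∃ (kp kc : ℕ) (g : Fin kp → E → ℝ) (h : Fin kc → E → ℝ),
      kp + kc ≤ Fintype.card E ∧
      (∀ i, I.IsPathFlow (g i)) ∧
      (∀ j, I.IsCycleFlow (h j)) ∧
      f = (∑ i, g i) + ∑ j, h j := by
  refine I.decomposes_of_decompositionRank_le _ hf.1 hf.2.2 hval ?_
  unfold FlowInstance.decompositionRank
  have := Finset.card_le_univ (Finset.univ.filter fun e => 0 < f e)
  split_ifs <;> omega
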